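/- Let n ≥ 1, κ = (κ₁,…,κₙ) ∈ ℕⁿ and let T : ℂ_κ[z₁,…,zₙ] → ℂ[z₁,…,zₙ] be a linear operator. Then T preserves stability (i.e., for every stable f ∈ ℂ_κ[z₁,…,zₙ] the polynomial T(f) is stable or identically zero) if and only if either (a) T has range of dimension at most one and is of the form T(f) = α(f)·P, where α is a linear functional on ℂ_κ[z₁,…,zₙ] and P is a stable polynomial, or (b) the algebraic symbol G_T(z,w) = T[(z+w)^κ] = Σ_{α ≤ κ} C(κ,α) T(z^α) w^{κ−α} is a stable polynomial in the 2n variables z₁,…,zₙ,w₁,…,wₙ. -/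

import Mathlib

open MvPolynomial

/-- A polynomial is *stable* if it is non-vanishing whenever all variables
lie in the open upper half-plane. -/
def IsStable {σ : Type*} (f : MvPolynomial σ ℂ) : Prop :=
  ∀ z : σ → ℂ, (∀ i, 0 < (z i).im) → MvPolynomial.eval z f ≠ 0

/-- The algebraic symbol `G_T(z,w) = T[(z+w)^κ] = ∑_{α ≤ κ} C(κ,α) T(z^α) w^{κ-α}`
of a linear operator `T`, viewed as a polynomial in the `2n` variables
`z₁,…,zₙ,w₁,…,wₙ` (the `z`-variables are indexed by `Sum.inl`, the `w`-variables
by `Sum.inr`). -/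
noncomputable def algSymbol {n : ℕ} (κ : Fin n →₀ ℕ)
    (T : MvPolynomial (Fin n) ℂ →ₗ[ℂ] MvPolynomial (Fin n) ℂ) :
    MvPolynomial (Fin n ⊕ Fin n) ℂ :=
  ∑ α ∈ Finset.Iic κ,
    C ((∏ i, (κ i).choose (α i) : ℕ) : ℂ) *
      (rename Sum.inl (T (monomial α 1)) *
        monomial (Finsupp.mapDomain Sum.inr (κ - α)) 1)

theorem bilinear_sub_ne_zero {A B C D : ℂ}
    (h : ∀ v w : ℂ, 0 < v.im → 0 < w.im → A + B * v + C * w + D * (v * w) ≠ 0)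
    {v w : ℂ} (hv : 0 < v.im) (hw : 0 < w.im) :
    A + B * v + C * w + (D * (v * w) - D) ≠ 0 := by
  by_cases hD : D = 0
  · simpa [hD] using h v w hv hw
  have hc : 0 ≤ (C / D).im := by
    by_contra! hneg
    set E : ℂ := (C * B - A * D) / D ^ 2 with hE
    have hpos : 0 < -(C / D).im := by linarith
    set s : ℝ := |(B / D).im| + 1 + ‖E‖ / (-(C / D).im) with hs
    have hs0 : 0 < s := by positivity
    have hsne : (s : ℂ) ≠ 0 := by exact_mod_cast hs0.ne'
    refine h (-(C / D) + E / (Complex.I * s)) (Complex.I * s - B / D) ?_ ?_ ?_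
    · have h1 : ‖E / (Complex.I * s)‖ < -(C / D).im := by
        rw [norm_div, norm_mul, Complex.norm_I, one_mul, Complex.norm_real,
          Real.norm_of_nonneg hs0.le, div_lt_iff₀ hs0, mul_comm, ← div_lt_iff₀ hpos, hs]
        have := abs_nonneg (B / D).im
        linarith
      have h2 := (abs_le.mp (Complex.abs_im_le_norm (E / (Complex.I * s)))).1
      rw [Complex.add_im, Complex.neg_im]
      linarith
    · have h1 : s > (B / D).im := by
        have := le_abs_self (B / D).im
        have : 0 ≤ ‖E‖ / (-(C / D).im) := by positivity
        linarith
      simpa using h1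
    · rw [hE]
      have := Complex.I_ne_zero
      field_simp
      ring
  have hvc : 0 < (v + C / D).im := by
    rw [Complex.add_im]; linarith
  have hvc0 : v + C / D ≠ 0 := by
    intro h0; rw [h0] at hvc; simp at hvc
  have hw' : 0 < (w - 1 / (v + C / D)).im := by
    have : (1 / (v + C / D)).im < 0 := by
      rw [one_div, Complex.inv_im]
      exact div_neg_of_neg_of_pos (by linarith) (Complex.normSq_pos.mpr hvc0)
    rw [Complex.sub_im]; linarith
  have key := h v (w - 1 / (v + C / D)) hv hw'
  intro h0
  apply key
  have h1 : (C + D * v) * (1 / (v + C / D)) = D := by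
    have : D * v + C ≠ 0 := by
      intro h'
      apply hvc0
      field_simp
      linear_combination h'
    have : v * D + C ≠ 0 := by rwa [mul_comm v D]
    field_simp
    ring
  linear_combination h0 - h1

theorem norm_two_mul_sum_add_le {y : ℝ} (s : Multiset ℂ) (z : ℂ)
    (hs : ∀ r ∈ s, ‖2 * y * (1 / (z - r)) + Complex.I‖ ≤ 1) :
    ‖2 * y * (s.map fun r => 1 / (z - r)).sum + s.card * Complex.I‖ ≤ s.card := by
  induction s using Multiset.induction_on with
  | empty => simp
  | cons a s ih =>
    have h1 := ih fun r hr => hs r (Multiset.mem_cons_of_mem hr)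
    have h2 := hs a (Multiset.mem_cons_self a s)
    simp only [Multiset.map_cons, Multiset.sum_cons, Multiset.card_cons, Nat.cast_add, Nat.cast_one]
    calc _ = ‖(2 * y * (s.map fun r => 1 / (z - r)).sum + s.card * Complex.I) +
          (2 * y * (1 / (z - a)) + Complex.I)‖ := by ring_nf
      _ ≤ _ := (norm_add_le _ _).trans (add_le_add h1 h2)

theorem norm_inv_add_I_le_one_iff {x : ℂ} {y : ℝ} (hx : x ≠ 0) (hy : 0 < y) :
    ‖2 * y * (1 / x) + Complex.I‖ ≤ 1 ↔ y ≤ x.im := by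
  have h1 : 2 * y * (1 / x) + Complex.I = (2 * y + Complex.I * x) / x := by
    field_simp
  rw [h1, norm_div, div_le_one (norm_pos_iff.mpr hx), ← sq_le_sq₀ (norm_nonneg _) (norm_nonneg _),
    ← Complex.normSq_eq_norm_sq, ← Complex.normSq_eq_norm_sq, Complex.normSq_apply,
    Complex.normSq_apply]
  simp
  constructor
  · intro h; nlinarith
  · intro h; nlinarith

open Polynomial in
theorem laguerre_polar_ne_zero {p : ℂ[X]} {N : ℕ} (hN : 0 < N) (hp : p.natDegree ≤ N)
    (h : ∀ z : ℂ, 0 < z.im → p.eval z ≠ 0) {z ζ : ℂ} (hz : 0 < z.im) (hζ : 0 < ζ.im) :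
    N * p.eval z + (ζ - z) * p.derivative.eval z ≠ 0 := by
  intro h0
  have hpz := h z hz
  have hp0 : p ≠ 0 := by rintro rfl; simp at hpz
  have hNC : (N : ℂ) ≠ 0 := by exact_mod_cast hN.ne'
  have hlog := (IsAlgClosed.splits p).eval_derivative_div_eval_of_ne_zero hpz
  set S := (p.roots.map fun r => 1 / (z - r)).sum with hS
  have hd : p.derivative.eval z = p.eval z * S := by rw [← hlog]; field_simp
  have h2 : (N : ℂ) + (ζ - z) * S = 0 := by
    have : p.eval z * (N + (ζ - z) * S) = 0 := by rw [hd] at h0; linear_combination h0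
    exact (mul_eq_zero.mp this).resolve_left hpz
  have hzζ : z - ζ ≠ 0 := by
    intro h'
    have : ζ - z = 0 := by linear_combination -h'
    rw [this] at h2
    simp at h2
    omega
  have hSval : S = N * (1 / (z - ζ)) := by
    field_simp
    linear_combination -h2
  have hb := norm_two_mul_sum_add_le (y := z.im) p.roots z (by
    intro r hr
    have hr0 : p.eval r = 0 := (Polynomial.mem_roots hp0).mp hr
    have hrim : r.im ≤ 0 := by
      by_contra! hc
      exact h r hc hr0
    refine (norm_inv_add_I_le_one_iff ?_ hz).mpr ?_
    · intro h'
      exact hpz (by rw [sub_eq_zero.mp h', hr0])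
    · rw [Complex.sub_im]; linarith)
  rw [← hS] at hb
  have hcard : p.roots.card ≤ N := (Polynomial.card_roots' p).trans hp
  have hb2 : ‖2 * z.im * S + N * Complex.I‖ ≤ N := by
    calc ‖2 * z.im * S + N * Complex.I‖
        = ‖(2 * z.im * S + p.roots.card * Complex.I) + ((N - p.roots.card : ℕ) : ℂ) * Complex.I‖ := by
          rw [Nat.cast_sub hcard]; ring_nf
      _ ≤ p.roots.card + ((N - p.roots.card : ℕ) : ℝ) := by
          refine (norm_add_le _ _).trans (add_le_add hb ?_)
          simp
      _ = N := by rw [Nat.cast_sub hcard]; ring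
  have hb3 : ‖2 * z.im * (1 / (z - ζ)) + Complex.I‖ ≤ 1 := by
    have : 2 * z.im * S + N * Complex.I = N * (2 * z.im * (1 / (z - ζ)) + Complex.I) := by
      rw [hSval]; ring
    rw [this, norm_mul, Complex.norm_natCast] at hb2
    have hNR : (0 : ℝ) < N := by exact_mod_cast hN
    nlinarith
  rw [norm_inv_add_I_le_one_iff hzζ hz, Complex.sub_im] at hb3
  linarith

open Finset in
theorem polar_sum_ne_zero {k : ℕ} {c : ℕ → ℂ}
    (h : ∀ v : ℂ, 0 < v.im → ∑ a ∈ range (k + 2), c a * v ^ a ≠ 0)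
    {v v' : ℂ} (hv : 0 < v.im) (hv' : 0 < v'.im) :
    ∑ a ∈ range (k + 2), c a * ((1 - a / (k + 1)) * v ^ a + a / (k + 1) * v' * v ^ (a - 1)) ≠ 0 := by
  set p : Polynomial ℂ := ∑ a ∈ range (k + 2), Polynomial.C (c a) * Polynomial.X ^ a with hp
  have hdeg : p.natDegree ≤ k + 1 := by
    refine Polynomial.natDegree_sum_le_of_forall_le _ _ fun a ha => ?_
    exact (Polynomial.natDegree_C_mul_X_pow_le _ _).trans (by simp at ha; omega)
  have key := laguerre_polar_ne_zero (p := p) (Nat.succ_pos k) hdeg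
    (fun z hz => by simpa [hp, Polynomial.eval_finsetSum] using h z hz) hv hv'
  have hk : (k + 1 : ℂ) ≠ 0 := by exact_mod_cast Nat.succ_ne_zero k
  intro h0
  apply key
  rw [hp, Polynomial.derivative_sum, Polynomial.eval_finsetSum, Polynomial.eval_finsetSum,
    mul_sum, mul_sum, ← sum_add_distrib, ← mul_zero (k + 1 : ℂ), ← h0, mul_sum]
  refine sum_congr rfl fun a _ => ?_
  rcases a with _ | a
  · simp
  · rw [Polynomial.derivative_C_mul, Polynomial.derivative_X_pow]
    simp only [Polynomial.eval_mul, Polynomial.eval_C, Polynomial.eval_pow, Polynomial.eval_X,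
      Nat.add_sub_cancel]
    push_cast
    field_simp
    ring

open Finset in
theorem sum_shift_adjoint (k : ℕ) (x y : ℂ) (c ψ : ℕ → ℂ) :
    ∑ a ∈ range (k + 1), ((1 - a / (k + 1)) * x * c a + (a + 1) / (k + 1) * y * c (a + 1)) * ψ a =
      ∑ a ∈ range (k + 2), c a * ((1 - a / (k + 1)) * x * ψ a + a / (k + 1) * y * ψ (a - 1)) := by
  have hk : (k + 1 : ℂ) ≠ 0 := by exact_mod_cast Nat.succ_ne_zero k
  simp only [add_mul, mul_add, sum_add_distrib]
  congr 1
  · rw [sum_range_succ _ (k + 1)]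
    have : (1 - ((k + 1 : ℕ) : ℂ) / (k + 1)) = 0 := by push_cast; field_simp; ring
    rw [this]
    simp only [zero_mul, mul_zero, add_zero]
    exact sum_congr rfl fun a _ => by ring
  · rw [sum_range_succ' _ (k + 1)]
    simp only [Nat.cast_zero, zero_div, zero_mul, mul_zero, add_zero]
    exact sum_congr rfl fun a _ => by push_cast; ring

open Finset in
theorem sum_sum_shift_adjoint (k : ℕ) (x y : ℂ) (c ψ : ℕ → ℕ → ℂ) :
    ∑ a ∈ range (k + 1), ∑ b ∈ range (k + 1),
      ((1 - b / (k + 1)) * x * ((1 - a / (k + 1)) * x * c a b + (a + 1) / (k + 1) * y * c (a + 1) b)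
        + (b + 1) / (k + 1) * y *
          ((1 - a / (k + 1)) * x * c a (b + 1) + (a + 1) / (k + 1) * y * c (a + 1) (b + 1))) *
        ψ a b =
      ∑ a ∈ range (k + 2), ∑ b ∈ range (k + 2), c a b *
        ((1 - b / (k + 1)) * x * ((1 - a / (k + 1)) * x * ψ a b + a / (k + 1) * y * ψ (a - 1) b)
        + b / (k + 1) * y *
          ((1 - a / (k + 1)) * x * ψ a (b - 1) + a / (k + 1) * y * ψ (a - 1) (b - 1))) := by
  calc _ = ∑ a ∈ range (k + 1), ∑ b ∈ range (k + 2),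
        ((1 - a / (k + 1)) * x * c a b + (a + 1) / (k + 1) * y * c (a + 1) b) *
          ((1 - b / (k + 1)) * x * ψ a b + b / (k + 1) * y * ψ a (b - 1)) :=
        sum_congr rfl fun a _ => sum_shift_adjoint k x y
          (fun b => (1 - a / (k + 1)) * x * c a b + (a + 1) / (k + 1) * y * c (a + 1) b) (ψ a)
    _ = ∑ b ∈ range (k + 2), ∑ a ∈ range (k + 1),
        ((1 - a / (k + 1)) * x * c a b + (a + 1) / (k + 1) * y * c (a + 1) b) *
          ((1 - b / (k + 1)) * x * ψ a b + b / (k + 1) * y * ψ a (b - 1)) := sum_comm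
    _ = ∑ b ∈ range (k + 2), ∑ a ∈ range (k + 2), c a b *
          ((1 - a / (k + 1)) * x *
              ((1 - b / (k + 1)) * x * ψ a b + b / (k + 1) * y * ψ a (b - 1)) +
            a / (k + 1) * y *
              ((1 - b / (k + 1)) * x * ψ (a - 1) b + b / (k + 1) * y * ψ (a - 1) (b - 1))) :=
        sum_congr rfl fun b _ => sum_shift_adjoint k x y (fun a => c a b)
          (fun a => (1 - b / (k + 1)) * x * ψ a b + b / (k + 1) * y * ψ a (b - 1))
    _ = _ := by
      rw [sum_comm]
      refine sum_congr rfl fun a _ => sum_congr rfl fun b _ => ?_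
      ring

open Finset in
theorem sum_sum_ne_zero_congr {ι κ : Type*} {s : Finset ι} {t : Finset κ} {F G : ι → κ → ℂ}
    (h : ∑ a ∈ s, ∑ b ∈ t, F a b ≠ 0) (hFG : ∀ a b, F a b = G a b) :
    ∑ a ∈ s, ∑ b ∈ t, G a b ≠ 0 := by
  simpa only [hFG] using h

/-- Weights of a perturbed contraction functional on polynomials of bidegree at most `(k, k)`. -/
noncomputable def contractionWeight (e : ℂ) : ℕ → ℕ → ℕ → ℂ
  | 0, _, _ => 1
  | k + 1, a, b =>
    (1 - b / (k + 1)) * ((1 - a / (k + 1)) * contractionWeight e k a b +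
        a / (k + 1) * e * contractionWeight e k (a - 1) b) +
      b / (k + 1) * e * ((1 - a / (k + 1)) * contractionWeight e k a (b - 1) +
        a / (k + 1) * e * contractionWeight e k (a - 1) (b - 1)) -
      b / (k + 1) * (a / (k + 1)) * contractionWeight e k (a - 1) (b - 1)

theorem continuous_contractionWeight (k a b : ℕ) :
    Continuous fun e => contractionWeight e k a b := by
  induction k generalizing a b with
  | zero => simpa [contractionWeight] using continuous_const
  | succ k ih =>
    have h1 := ih a b
    have h2 := ih (a - 1) b
    have h3 := ih a (b - 1)
    have h4 := ih (a - 1) (b - 1)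
    simp only [contractionWeight]
    fun_prop

theorem contractionWeight_zero {k a b : ℕ} (ha : a ≤ k) (hb : b ≤ k) :
    contractionWeight 0 k a b = if a = b then (-1) ^ a / (k.choose a : ℂ) else 0 := by
  induction k generalizing a b with
  | zero =>
    obtain rfl : a = 0 := by omega
    obtain rfl : b = 0 := by omega
    simp [contractionWeight]
  | succ k ih =>
    have hk : (k + 1 : ℂ) ≠ 0 := by exact_mod_cast Nat.succ_ne_zero k
    have hA : (1 - (b : ℂ) / (k + 1)) * ((1 - a / (k + 1)) * contractionWeight 0 k a b) =
        (1 - (b : ℂ) / (k + 1)) * ((1 - a / (k + 1)) *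
          if a = b then (-1) ^ a / (k.choose a : ℂ) else 0) := by
      rcases Nat.lt_or_ge k a with h | h
      · obtain rfl : a = k + 1 := by omega
        have : (1 - ((k + 1 : ℕ) : ℂ) / (k + 1)) = 0 := by push_cast; field_simp; ring
        rw [this]; simp
      rcases Nat.lt_or_ge k b with h' | h'
      · obtain rfl : b = k + 1 := by omega
        have : (1 - ((k + 1 : ℕ) : ℂ) / (k + 1)) = 0 := by push_cast; field_simp; ring
        rw [this]; simp
      rw [ih h h']
    have hB : (b : ℂ) / (k + 1) * (a / (k + 1)) * contractionWeight 0 k (a - 1) (b - 1) =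
        (b : ℂ) / (k + 1) * (a / (k + 1)) *
          if a = b then (-1) ^ (a - 1) / (k.choose (a - 1) : ℂ) else 0 := by
      rcases a with _ | a
      · simp
      rcases b with _ | b
      · simp
      rw [ih (by omega) (by omega)]
      simp
    simp only [contractionWeight, mul_zero, zero_mul, add_zero]
    rw [hA, hB]
    split_ifs with hab
    swap
    · simp
    subst hab
    rcases a with _ | a
    · simp
    have hc1 : ((k.choose a : ℕ) : ℂ) ≠ 0 := by
      exact_mod_cast (Nat.choose_pos (by omega)).ne'
    have hc2 : (((k + 1).choose (a + 1) : ℕ) : ℂ) ≠ 0 := by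
      exact_mod_cast (Nat.choose_pos ha).ne'
    have e1 : ((k + 1 : ℕ) : ℂ) * (k.choose a : ℕ) = ((k + 1).choose (a + 1) : ℕ) * (a + 1 : ℕ) := by
      exact_mod_cast Nat.add_one_mul_choose_eq k a
    have hBB : ((a + 1 : ℕ) : ℂ) / (k + 1) * ((a + 1 : ℕ) / (k + 1)) *
        ((-1) ^ (a + 1 - 1) / (k.choose (a + 1 - 1) : ℂ)) =
        - ((a + 1) / (k + 1) * ((-1) ^ (a + 1) / ((k + 1).choose (a + 1) : ℂ))) := by
      push_cast at e1
      simp only [Nat.add_sub_cancel, pow_succ]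
      push_cast
      field_simp
      linear_combination -e1
    have hAA : (1 - ((a + 1 : ℕ) : ℂ) / (k + 1)) * ((1 - ((a + 1 : ℕ) : ℂ) / (k + 1)) *
        ((-1) ^ (a + 1) / (k.choose (a + 1) : ℂ))) =
        (1 - (a + 1) / (k + 1)) * ((-1) ^ (a + 1) / ((k + 1).choose (a + 1) : ℂ)) := by
      rcases Nat.lt_or_ge k (a + 1) with h | h
      · obtain rfl : k = a := by omega
        have : (1 - ((k : ℂ) + 1) / (k + 1)) = 0 := by field_simp; ring
        push_cast
        rw [this]; simp
      have hc3 : ((k.choose (a + 1) : ℕ) : ℂ) ≠ 0 := by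
        exact_mod_cast (Nat.choose_pos h).ne'
      have e2 : ((k + 1 : ℕ) : ℂ) * (k.choose (a + 1) : ℕ) =
          ((k + 1).choose (a + 1) : ℕ) * (k - a : ℕ) := by
        have := Nat.choose_mul_succ_eq k (a + 1)
        have h2 : k + 1 - (a + 1) = k - a := by omega
        rw [h2] at this
        rw [mul_comm]
        exact_mod_cast this
      rw [Nat.cast_sub (by omega)] at e2
      push_cast at e2 ⊢
      field_simp
      linear_combination (-((k : ℂ) - a)) * e2
    rw [hAA, hBB]
    ring

open Finset in
theorem contraction_range_ne_zero {e : ℂ} (he : 0 < e.im) {k : ℕ} {c : ℕ → ℕ → ℂ}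
    (h : ∀ v w : ℂ, 0 < v.im → 0 < w.im →
      ∑ a ∈ range (k + 1), ∑ b ∈ range (k + 1), c a b * (v ^ a * w ^ b) ≠ 0) :
    ∑ a ∈ range (k + 1), ∑ b ∈ range (k + 1), c a b * contractionWeight e k a b ≠ 0 := by
  induction k generalizing c with
  | zero => simpa [contractionWeight] using h e e he he
  | succ k ih =>
    obtain ⟨c₁, hc₁⟩ : ∃ c₁ : ℕ → ℕ → ℂ, c₁ = fun a b : ℕ =>
      ((1 - b / (k + 1)) * 1 * ((1 - a / (k + 1)) * 1 * c a b + (a + 1) / (k + 1) * e * c (a + 1) b)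
        + (b + 1) / (k + 1) * e *
          ((1 - a / (k + 1)) * 1 * c a (b + 1) + (a + 1) / (k + 1) * e * c (a + 1) (b + 1))) := ⟨_, rfl⟩
    obtain ⟨c₂, hc₂⟩ : ∃ c₂ : ℕ → ℕ → ℂ, c₂ = fun a b : ℕ =>
      ((1 - b / (k + 1)) * 0 * ((1 - a / (k + 1)) * 0 * c a b + (a + 1) / (k + 1) * 1 * c (a + 1) b)
        + (b + 1) / (k + 1) * 1 *
          ((1 - a / (k + 1)) * 0 * c a (b + 1) + (a + 1) / (k + 1) * 1 * c (a + 1) (b + 1))) := ⟨_, rfl⟩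
    set c' : ℕ → ℕ → ℂ := fun a b => c₁ a b - c₂ a b with hc'
    have hadj : ∀ ψ : ℕ → ℕ → ℂ, ∑ a ∈ range (k + 1), ∑ b ∈ range (k + 1), c' a b * ψ a b =
        ∑ a ∈ range (k + 2), ∑ b ∈ range (k + 2), c a b *
          ((1 - b / (k + 1)) * ((1 - a / (k + 1)) * ψ a b + a / (k + 1) * e * ψ (a - 1) b) +
            b / (k + 1) * e * ((1 - a / (k + 1)) * ψ a (b - 1) +
              a / (k + 1) * e * ψ (a - 1) (b - 1)) -
            b / (k + 1) * (a / (k + 1)) * ψ (a - 1) (b - 1)) := by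
      intro ψ
      simp only [hc', sub_mul, sum_sub_distrib]
      simp only [hc₁, hc₂]
      rw [sum_sum_shift_adjoint, sum_sum_shift_adjoint, ← sum_sub_distrib]
      refine sum_congr rfl fun a _ => ?_
      rw [← sum_sub_distrib]
      refine sum_congr rfl fun b _ => ?_
      ring
    have hstep : ∑ a ∈ range (k + 2), ∑ b ∈ range (k + 2), c a b * contractionWeight e (k + 1) a b =
        ∑ a ∈ range (k + 1), ∑ b ∈ range (k + 1), c' a b * contractionWeight e k a b := by
      rw [hadj]
      rfl
    rw [hstep]
    refine ih fun v w hv hw => ?_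
    rw [hadj fun a b => v ^ a * w ^ b]
    have h1 : ∀ v' w' : ℂ, 0 < v'.im → 0 < w'.im →
        ∑ a ∈ range (k + 2), ∑ b ∈ range (k + 2), c a b *
          (((1 - a / (k + 1)) * v ^ a + a / (k + 1) * v' * v ^ (a - 1)) *
            ((1 - b / (k + 1)) * w ^ b + b / (k + 1) * w' * w ^ (b - 1))) ≠ 0 := by
      intro v' w' hv' hw'
      have h2 := polar_sum_ne_zero (k := k) (c := fun b => ∑ a ∈ range (k + 2),
          c a b * ((1 - a / (k + 1)) * v ^ a + a / (k + 1) * v' * v ^ (a - 1)))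
        (fun w hw => by
          have h3 := polar_sum_ne_zero (k := k) (c := fun a => ∑ b ∈ range (k + 2), c a b * w ^ b)
            (fun v hv => by
              have := h v w hv hw
              simp only [sum_mul]
              exact sum_sum_ne_zero_congr this fun _ _ => by ring) hv hv'
          simp only [sum_mul] at h3 ⊢
          rw [sum_comm]
          exact sum_sum_ne_zero_congr h3 fun _ _ => by ring) hw hw'
      simp only [sum_mul] at h2
      rw [sum_comm]
      exact sum_sum_ne_zero_congr h2 fun _ _ => by ring
    set S : (ℕ → ℕ → ℂ) → ℂ := fun X => ∑ a ∈ range (k + 2), ∑ b ∈ range (k + 2), c a b * X a b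
      with hS
    have hSadd : ∀ X Y : ℕ → ℕ → ℂ, S (fun a b => X a b + Y a b) = S X + S Y := by
      intro X Y; simp only [hS, mul_add, sum_add_distrib]
    have hSsmul : ∀ (x : ℂ) (X : ℕ → ℕ → ℂ), S (fun a b => x * X a b) = x * S X := by
      intro x X
      simp only [hS, mul_sum]
      exact sum_congr rfl fun a _ => sum_congr rfl fun b _ => by ring
    have h2 := bilinear_sub_ne_zero
      (A := S fun a b => (1 - a / (k + 1)) * v ^ a * ((1 - b / (k + 1)) * w ^ b))
      (B := S fun a b => a / (k + 1) * v ^ (a - 1) * ((1 - b / (k + 1)) * w ^ b))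
      (C := S fun a b => (1 - a / (k + 1)) * v ^ a * (b / (k + 1) * w ^ (b - 1)))
      (D := S fun a b => a / (k + 1) * v ^ (a - 1) * (b / (k + 1) * w ^ (b - 1)))
      (fun v' w' hv' hw' => by
        have := h1 v' w' hv' hw'
        rw [mul_comm _ v', mul_comm _ w', mul_comm _ (v' * w'), ← hSsmul, ← hSsmul, ← hSsmul,
          ← hSadd, ← hSadd, ← hSadd]
        exact sum_sum_ne_zero_congr this fun _ _ => by ring) he he
    have h3 : ∀ x y : ℂ, x * (e * e) - x = (e * e - 1) * x := fun x _ => by ring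
    rw [h3 _ 0, mul_comm _ e, mul_comm _ e, ← hSsmul, ← hSsmul, ← hSsmul, ← hSadd, ← hSadd,
      ← hSadd] at h2
    exact sum_sum_ne_zero_congr h2 fun _ _ => by ring

open Finset in
theorem contraction_family_ne_zero {e : ℂ} (he : 0 < e.im) {k : ℕ} {ι : Type*} {J : Finset ι}
    {a b : ι → ℕ} (ha : ∀ j ∈ J, a j ≤ k) (hb : ∀ j ∈ J, b j ≤ k) {d : ι → ℂ}
    (h : ∀ v w : ℂ, 0 < v.im → 0 < w.im → ∑ j ∈ J, d j * (v ^ a j * w ^ b j) ≠ 0) :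
    ∑ j ∈ J, d j * contractionWeight e k (a j) (b j) ≠ 0 := by
  classical
  have regroup : ∀ ψ : ℕ → ℕ → ℂ, ∑ x ∈ range (k + 1), ∑ y ∈ range (k + 1),
      (∑ j ∈ J with (a j, b j) = (x, y), d j) * ψ x y = ∑ j ∈ J, d j * ψ (a j) (b j) := by
    intro ψ
    have hmaps : ∀ j ∈ J, (a j, b j) ∈ range (k + 1) ×ˢ range (k + 1) := fun j hj => by
      have := ha j hj
      have := hb j hj
      simp only [mem_product, mem_range]
      omega
    rw [← sum_fiberwise_of_maps_to hmaps, sum_product]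
    refine sum_congr rfl fun x _ => sum_congr rfl fun y _ => ?_
    rw [sum_mul]
    refine sum_congr rfl fun j hj => ?_
    obtain ⟨rfl, rfl⟩ := Prod.mk.inj (mem_filter.mp hj).2
    rfl
  rw [← regroup]
  refine contraction_range_ne_zero he fun v w hv hw => ?_
  rw [regroup fun x y => v ^ x * w ^ y]
  exact h v w hv hw

open Finset in
theorem contraction_prod_ne_zero {e : ℂ} (he : 0 < e.im) {σ ι : Type*} [Fintype σ] [DecidableEq σ]
    {κ : σ → ℕ} {J : Finset ι} {a b : ι → σ → ℕ} (ha : ∀ j ∈ J, ∀ i, a j i ≤ κ i)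
    (hb : ∀ j ∈ J, ∀ i, b j i ≤ κ i) {c : ι → ℂ}
    (h : ∀ v w : σ → ℂ, (∀ i, 0 < (v i).im) → (∀ i, 0 < (w i).im) →
      ∑ j ∈ J, c j * ∏ i, (v i ^ a j i * w i ^ b j i) ≠ 0) :
    ∑ j ∈ J, c j * ∏ i, contractionWeight e (κ i) (a j i) (b j i) ≠ 0 := by
  have key : ∀ (S : Finset σ) (v w : σ → ℂ), (∀ i, 0 < (v i).im) → (∀ i, 0 < (w i).im) →
      ∑ j ∈ J, c j * ∏ i, (if i ∈ S then contractionWeight e (κ i) (a j i) (b j i)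
        else v i ^ a j i * w i ^ b j i) ≠ 0 := by
    intro S
    induction S using Finset.induction_on with
    | empty => simpa using h
    | insert i₀ S hi₀ ih =>
      intro v w hv hw
      have h1 := contraction_family_ne_zero he (J := J) (a := fun j => a j i₀)
        (b := fun j => b j i₀) (k := κ i₀)
        (d := fun j => c j * ∏ i ∈ univ.erase i₀, (if i ∈ S then
          contractionWeight e (κ i) (a j i) (b j i) else v i ^ a j i * w i ^ b j i))
        (fun j hj => ha j hj i₀) (fun j hj => hb j hj i₀) (fun x y hx hy => by
          have h2 := ih (Function.update v i₀ x) (Function.update w i₀ y)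
            (fun i => by by_cases hi : i = i₀ <;> simp [hi, hx, hv])
            (fun i => by by_cases hi : i = i₀ <;> simp [hi, hy, hw])
          convert! h2 using 2 with j hj
          rw [← mul_prod_erase univ _ (mem_univ i₀), if_neg hi₀, Function.update_self,
            Function.update_self, mul_assoc, mul_comm (∏ i ∈ univ.erase i₀, _)]
          congr 2
          refine prod_congr rfl fun i hi => ?_
          rw [Function.update_of_ne (ne_of_mem_erase hi), Function.update_of_ne (ne_of_mem_erase hi)])
      convert! h1 using 2 with j hj
      rw [← mul_prod_erase univ _ (mem_univ i₀), if_pos (mem_insert_self _ _), mul_assoc,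
        mul_comm (∏ i ∈ univ.erase i₀, _)]
      congr 2
      refine prod_congr rfl fun i hi => ?_
      simp [ne_of_mem_erase hi]
  simpa using key univ (fun _ => Complex.I) (fun _ => Complex.I) (by simp) (by simp)

theorem norm_prod_one_sub_le {δ : ℝ} (hδ : 0 < δ) (s : Multiset ℂ) (hs : ∀ r ∈ s, δ ≤ ‖r‖) :
    ‖(s.map fun r => 1 - r).prod‖ ≤ (1 + 1 / δ) ^ s.card * ‖(s.map fun r => 0 - r).prod‖ := by
  induction s using Multiset.induction_on with
  | empty => simp
  | cons a s ih =>
    have h1 := ih fun r hr => hs r (Multiset.mem_cons_of_mem hr)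
    have h2 := hs a (Multiset.mem_cons_self a s)
    simp only [Multiset.map_cons, Multiset.prod_cons, Multiset.card_cons, norm_mul]
    have h3 : ‖1 - a‖ ≤ (1 + 1 / δ) * ‖0 - a‖ := by
      have : 1 ≤ 1 / δ * ‖a‖ := by
        rw [one_div, inv_mul_eq_div, le_div_iff₀ hδ]; linarith
      calc ‖1 - a‖ ≤ ‖(1 : ℂ)‖ + ‖a‖ := norm_sub_le _ _
        _ ≤ _ := by rw [norm_one, zero_sub, norm_neg]; linarith
    calc _ ≤ ((1 + 1 / δ) * ‖0 - a‖) *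
          ((1 + 1 / δ) ^ s.card * ‖(s.map fun r => 0 - r).prod‖) := by gcongr
      _ = _ := by ring

open Polynomial in
theorem norm_eval_one_le_of_ne_zero {p : ℂ[X]} {D : ℕ} (hp : p.natDegree ≤ D) {δ : ℝ} (hδ : 0 < δ)
    (h : ∀ t : ℂ, ‖t‖ < δ → p.eval t ≠ 0) :
    ‖p.eval 1‖ ≤ (1 + 1 / δ) ^ D * ‖p.eval 0‖ := by
  have hp0 : p ≠ 0 := by
    rintro rfl
    exact h 0 (by simpa using hδ) (by simp)
  rw [(IsAlgClosed.splits p).eval_eq_prod_roots, (IsAlgClosed.splits p).eval_eq_prod_roots,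
    norm_mul, norm_mul]
  have h1 := norm_prod_one_sub_le hδ p.roots fun r hr => by
    by_contra! hlt
    exact h r hlt ((Polynomial.mem_roots hp0).mp hr)
  have h2 : (1 + 1 / δ) ^ p.roots.card ≤ (1 + 1 / δ) ^ D :=
    pow_le_pow_right₀ (by have : 0 < 1 / δ := by positivity
                          linarith) ((Polynomial.card_roots' p).trans hp)
  calc _ ≤ ‖p.leadingCoeff‖ *
        ((1 + 1 / δ) ^ D * ‖(p.roots.map fun r => 0 - r).prod‖) := by
        gcongr
        exact h1.trans (by gcongr)
    _ = _ := by ring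

theorem exists_norm_eval_le_of_isStable {σ : Type*} [Finite σ] {z₀ : σ → ℂ}
    (hz₀ : ∀ i, 0 < (z₀ i).im) (z₁ : σ → ℂ) (D : ℕ) :
    ∃ K : ℝ, ∀ f : MvPolynomial σ ℂ, IsStable f → f.totalDegree ≤ D →
      ‖eval z₁ f‖ ≤ K * ‖eval z₀ f‖ := by
  obtain ⟨δ, hδ, hball⟩ : ∃ δ > 0, ∀ t : ℂ, ‖t‖ < δ → ∀ i, 0 < (z₀ i + t * (z₁ i - z₀ i)).im := by
    have : ∀ᶠ t in nhds (0 : ℂ), ∀ i, 0 < (z₀ i + t * (z₁ i - z₀ i)).im := by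
      rw [Filter.eventually_all]
      intro i
      have hc : Continuous fun t : ℂ => (z₀ i + t * (z₁ i - z₀ i)).im :=
        Complex.continuous_im.comp (by fun_prop)
      exact hc.continuousAt.eventually_const_lt (by simpa using hz₀ i)
    obtain ⟨δ, hδ, h⟩ := Metric.eventually_nhds_iff.mp this
    exact ⟨δ, hδ, fun t ht => h (by simpa using ht)⟩
  refine ⟨(1 + 1 / δ) ^ D, fun f hf hD => ?_⟩
  set p : Polynomial ℂ :=
    aeval (fun i => Polynomial.C (z₁ i - z₀ i) * Polynomial.X + Polynomial.C (z₀ i)) f with hp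
  have heval : ∀ t : ℂ, p.eval t = eval (fun i => z₀ i + t * (z₁ i - z₀ i)) f := by
    intro t
    rw [hp, ← Polynomial.coe_evalRingHom, ← MvPolynomial.eval₂_id, MvPolynomial.aeval_def,
      MvPolynomial.hom_eval₂]
    congr 1
    · ext x; simp
    · ext i
      simp
      ring
  have hdeg : p.natDegree ≤ D := by
    simpa using aeval_natDegree_le f hD _ fun i => Polynomial.natDegree_linear_le
  have := norm_eval_one_le_of_ne_zero hdeg hδ fun t ht => by
    rw [heval]
    exact hf _ (hball t ht)
  simpa [heval] using this

theorem isStable_or_eq_zero_of_tendsto {σ ι : Type*} [Finite σ] {l : Filter ι} [l.NeBot]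
    {h : ι → MvPolynomial σ ℂ} {f : MvPolynomial σ ℂ} {D : ℕ} (hs : ∀ᶠ x in l, IsStable (h x))
    (hD : ∀ᶠ x in l, (h x).totalDegree ≤ D)
    (hlim : ∀ z, Filter.Tendsto (fun x => eval z (h x)) l (nhds (eval z f))) :
    IsStable f ∨ f = 0 := by
  by_contra! hcon
  obtain ⟨hns, hne⟩ := hcon
  rw [IsStable] at hns
  push Not at hns
  obtain ⟨z₀, hz₀, h0⟩ := hns
  apply hne
  refine MvPolynomial.funext fun z₁ => ?_
  obtain ⟨K, hK⟩ := exists_norm_eval_le_of_isStable hz₀ z₁ D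
  have := le_of_tendsto_of_tendsto (hlim z₁).norm ((hlim z₀).norm.const_mul K)
    (by filter_upwards [hs, hD] with x h1 h2 using hK _ h1 h2)
  rw [h0, norm_zero, mul_zero] at this
  simpa using this

theorem sum_Iic_eq_sum_piFinset {n : ℕ} {M : Type*} [AddCommMonoid M] (κ : Fin n →₀ ℕ)
    (F : (Fin n → ℕ) → M) :
    ∑ α ∈ Finset.Iic κ, F α = ∑ p ∈ Fintype.piFinset fun i => Finset.range (κ i + 1), F p := by
  refine Finset.sum_bij' (fun α _ => α) (fun p _ => Finsupp.equivFunOnFinite.symm p) ?_ ?_ ?_ ?_ ?_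
  · intro α hα
    rw [Finset.mem_Iic] at hα
    simpa [Nat.lt_succ_iff] using fun i => hα i
  · intro p hp
    rw [Finset.mem_Iic]
    simpa [Nat.lt_succ_iff, Finsupp.le_def] using hp
  · intro α _
    ext i
    rfl
  · intro p _
    rfl
  · intro α _
    rfl

theorem prod_add_pow_eq_sum_Iic {n : ℕ} (κ : Fin n →₀ ℕ) (z w : Fin n → ℂ) :
    ∏ i, (z i + w i) ^ κ i =
      ∑ α ∈ Finset.Iic κ, ∏ i, (z i ^ α i * w i ^ (κ i - α i) * ((κ i).choose (α i) : ℂ)) := by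
  rw [sum_Iic_eq_sum_piFinset κ
    fun α => ∏ i, (z i ^ α i * w i ^ (κ i - α i) * ((κ i).choose (α i) : ℂ)),
    ← Finset.prod_univ_sum (fun i => Finset.range (κ i + 1))
      fun i a => z i ^ a * w i ^ (κ i - a) * ((κ i).choose a : ℂ)]
  exact Finset.prod_congr rfl fun i _ => add_pow _ _ _

theorem eval_algSymbol {n : ℕ} (κ : Fin n →₀ ℕ)
    (T : MvPolynomial (Fin n) ℂ →ₗ[ℂ] MvPolynomial (Fin n) ℂ) (z w : Fin n → ℂ) :
    eval (Sum.elim z w) (algSymbol κ T) = ∑ α ∈ Finset.Iic κ,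
      (∏ i, (w i ^ (κ i - α i) * ((κ i).choose (α i) : ℂ))) * eval z (T (monomial α 1)) := by
  rw [algSymbol, map_sum]
  refine Finset.sum_congr rfl fun α _ => ?_
  have h1 : ((κ - α).mapDomain Sum.inr : Fin n ⊕ Fin n →₀ ℕ).prod
      (fun i e => (Sum.elim z w) i ^ e) = ∏ i, w i ^ (κ i - α i) := by
    rw [Finsupp.prod_mapDomain_index (by simp) (by intros; rw [pow_add]),
      Finsupp.prod_fintype _ _ (by simp)]
    simp
  rw [map_mul, map_mul, eval_C, eval_monomial, eval_rename, Sum.elim_comp_inl, h1,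
    Finset.prod_mul_distrib]
  push_cast
  ring

theorem eq_sum_Iic_of_degreeOf_le {n : ℕ} {κ : Fin n →₀ ℕ} {f : MvPolynomial (Fin n) ℂ}
    (hf : ∀ i, f.degreeOf i ≤ κ i) : f = ∑ α ∈ Finset.Iic κ, f.coeff α • monomial α 1 := by
  conv_lhs => rw [f.as_sum]
  have hsub : f.support ⊆ Finset.Iic κ := fun α hα => by
    rw [Finset.mem_Iic]
    exact fun i => (monomial_le_degreeOf i hα).trans (hf i)
  rw [Finset.sum_subset hsub fun α _ hα => by rw [notMem_support_iff.mp hα, map_zero]]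
  exact Finset.sum_congr rfl fun α _ => by rw [smul_monomial, smul_eq_mul, mul_one]

theorem degreeOf_sum_Iic_le {n : ℕ} (κ : Fin n →₀ ℕ) (c : (Fin n →₀ ℕ) → ℂ) (i : Fin n) :
    (∑ α ∈ Finset.Iic κ, c α • monomial α (1 : ℂ)).degreeOf i ≤ κ i := by
  refine (degreeOf_sum_le i _ _).trans (Finset.sup_le fun α hα => ?_)
  rw [smul_monomial, smul_eq_mul, mul_one]
  by_cases h : c α = 0
  · simp [h]
  · rw [degreeOf_monomial_eq α i h]
    exact Finset.mem_Iic.mp hα i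

theorem linearMap_apply_eq_sum_Iic {n : ℕ} {κ : Fin n →₀ ℕ} {f : MvPolynomial (Fin n) ℂ}
    (hf : ∀ i, f.degreeOf i ≤ κ i) (T : MvPolynomial (Fin n) ℂ →ₗ[ℂ] MvPolynomial (Fin n) ℂ) :
    T f = ∑ α ∈ Finset.Iic κ, f.coeff α • T (monomial α 1) := by
  conv_lhs => rw [eq_sum_Iic_of_degreeOf_le hf]
  simp only [map_sum, map_smul]

theorem eval_eq_sum_Iic {n : ℕ} {κ : Fin n →₀ ℕ} {f : MvPolynomial (Fin n) ℂ}
    (hf : ∀ i, f.degreeOf i ≤ κ i) (z : Fin n → ℂ) :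
    eval z f = ∑ α ∈ Finset.Iic κ, f.coeff α * ∏ i, z i ^ α i := by
  conv_lhs => rw [eq_sum_Iic_of_degreeOf_le hf]
  simp [map_sum, smul_eval, eval_monomial, Finsupp.prod_fintype]

/-- The polynomial `(z + w)^κ` in the variables `z`. -/
noncomputable def shiftedPower {n : ℕ} (κ : Fin n →₀ ℕ) (w : Fin n → ℂ) :
    MvPolynomial (Fin n) ℂ :=
  ∑ α ∈ Finset.Iic κ,
    (∏ i, (w i ^ (κ i - α i) * ((κ i).choose (α i) : ℂ))) • monomial α 1

theorem eval_shiftedPower {n : ℕ} (κ : Fin n →₀ ℕ) (z w : Fin n → ℂ) :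
    eval z (shiftedPower κ w) = ∏ i, (z i + w i) ^ κ i := by
  rw [prod_add_pow_eq_sum_Iic, shiftedPower, map_sum]
  refine Finset.sum_congr rfl fun α _ => ?_
  rw [smul_eval, eval_monomial, Finsupp.prod_fintype _ _ (by simp), one_mul,
    ← Finset.prod_mul_distrib]
  exact Finset.prod_congr rfl fun i _ => by ring

theorem eval_map_shiftedPower {n : ℕ} (κ : Fin n →₀ ℕ)
    (T : MvPolynomial (Fin n) ℂ →ₗ[ℂ] MvPolynomial (Fin n) ℂ) (z w : Fin n → ℂ) :
    eval z (T (shiftedPower κ w)) = eval (Sum.elim z w) (algSymbol κ T) := by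
  rw [eval_algSymbol, shiftedPower, map_sum, map_sum]
  simp only [map_smul, smul_eval]

theorem degreeOf_shiftedPower_le {n : ℕ} (κ : Fin n →₀ ℕ) (w : Fin n → ℂ) (i : Fin n) :
    (shiftedPower κ w).degreeOf i ≤ κ i :=
  degreeOf_sum_Iic_le κ _ i

theorem isStable_shiftedPower {n : ℕ} (κ : Fin n →₀ ℕ) {w : Fin n → ℂ}
    (hw : ∀ i, 0 < (w i).im) : IsStable (shiftedPower κ w) := by
  intro z hz
  rw [eval_shiftedPower, Finset.prod_ne_zero_iff]
  intro i _
  refine pow_ne_zero _ fun h0 => ?_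
  have := congrArg Complex.im h0
  rw [Complex.add_im, Complex.zero_im] at this
  linarith [hz i, hw i]

theorem exists_norm_eval_le_shiftedPower {n : ℕ} {κ : Fin n →₀ ℕ} {w : Fin n → ℂ}
    (hw : ∀ i, 0 < (w i).im) {g : MvPolynomial (Fin n) ℂ} (hg : ∀ i, g.degreeOf i ≤ κ i) :
    ∃ K : ℝ, 0 ≤ K ∧ ∀ z : Fin n → ℂ, (∀ i, 0 < (z i).im) →
      ‖eval z g‖ ≤ K * ‖eval z (shiftedPower κ w)‖ := by
  set M : Fin n → ℝ := fun i => 1 + (1 + ‖w i‖) / (w i).im with hM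
  have hM0 : ∀ i, 0 ≤ M i := fun i => by
    have := hw i
    positivity
  refine ⟨(∑ α ∈ Finset.Iic κ, ‖g.coeff α‖) * ∏ i, M i ^ κ i,
    mul_nonneg (Finset.sum_nonneg fun _ _ => norm_nonneg _)
      (Finset.prod_nonneg fun i _ => pow_nonneg (hM0 i) _), fun z hz => ?_⟩
  have hlow : ∀ i, (w i).im ≤ ‖z i + w i‖ := fun i => by
    have := Complex.abs_im_le_norm (z i + w i)
    have h2 := le_abs_self (z i + w i).im
    rw [Complex.add_im] at this h2
    linarith [hz i]
  have hbig : ∀ i, (1 + ‖w i‖) + ‖z i + w i‖ ≤ M i * ‖z i + w i‖ := fun i => by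
    have : 1 + ‖w i‖ ≤ (1 + ‖w i‖) / (w i).im * ‖z i + w i‖ := by
      rw [div_mul_eq_mul_div, le_div_iff₀ (hw i)]
      exact mul_le_mul_of_nonneg_left (hlow i) (by positivity)
    simp only [hM, add_mul (1 : ℝ), one_mul]
    linarith
  have hone : ∀ i, 1 ≤ M i * ‖z i + w i‖ := fun i => by
    linarith [hbig i, norm_nonneg (w i), norm_nonneg (z i + w i)]
  have hzle : ∀ i, ‖z i‖ ≤ M i * ‖z i + w i‖ := fun i => by
    have : ‖z i‖ ≤ ‖z i + w i‖ + ‖w i‖ := by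
      simpa using norm_sub_le (z i + w i) (w i)
    linarith [hbig i]
  rw [eval_eq_sum_Iic hg, eval_shiftedPower, norm_prod, mul_assoc, ← Finset.prod_mul_distrib,
    Finset.sum_mul]
  refine (norm_sum_le _ _).trans (Finset.sum_le_sum fun α hα => ?_)
  rw [norm_mul, norm_prod]
  refine mul_le_mul_of_nonneg_left (Finset.prod_le_prod (fun _ _ => norm_nonneg _) fun i _ => ?_)
    (norm_nonneg _)
  rw [norm_pow, norm_pow, ← mul_pow]
  exact (pow_le_pow_left₀ (norm_nonneg _) (hzle i) _).trans
    (pow_le_pow_right₀ (hone i) (Finset.mem_Iic.mp hα i))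

/-- If a stability preserver kills some `(z + w)^κ` with `w` in the open upper half-plane, then
every polynomial of degree at most `κ` has a stable or zero image. -/
theorem isStable_or_eq_zero_of_map_shiftedPower_eq_zero {n : ℕ} {κ : Fin n →₀ ℕ}
    {T : MvPolynomial (Fin n) ℂ →ₗ[ℂ] MvPolynomial (Fin n) ℂ}
    (hT : ∀ f : MvPolynomial (Fin n) ℂ, (∀ i, f.degreeOf i ≤ κ i) → IsStable f →
      IsStable (T f) ∨ T f = 0)
    {w : Fin n → ℂ} (hw : ∀ i, 0 < (w i).im) (h0 : T (shiftedPower κ w) = 0)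
    {g : MvPolynomial (Fin n) ℂ} (hg : ∀ i, g.degreeOf i ≤ κ i) : IsStable (T g) ∨ T g = 0 := by
  obtain ⟨K, hK0, hK⟩ := exists_norm_eval_le_shiftedPower hw hg
  have hK1 : 0 < K + 1 := by linarith
  have hK1' : ((K + 1 : ℝ) : ℂ) ≠ 0 := by exact_mod_cast hK1.ne'
  have hstable : IsStable (((K + 1 : ℝ) : ℂ) • shiftedPower κ w + g) := by
    intro z hz hzero
    have hp := norm_pos_iff.mpr (isStable_shiftedPower κ hw z hz)
    rw [map_add, smul_eval, add_eq_zero_iff_eq_neg] at hzero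
    have h1 := congrArg norm hzero
    rw [norm_mul, norm_neg, Complex.norm_real, Real.norm_of_nonneg hK1.le] at h1
    have := hK z hz
    nlinarith
  have hdeg : ∀ i, (((K + 1 : ℝ) : ℂ) • shiftedPower κ w + g).degreeOf i ≤ κ i := fun i => by
    refine (degreeOf_add_le i _ _).trans (max_le ?_ (hg i))
    rw [smul_eq_C_mul]
    exact (degreeOf_C_mul_le _ _ _).trans (degreeOf_shiftedPower_le κ w i)
  simpa [h0] using hT _ hdeg hstable

theorem exists_functional_of_forall_isStable_or_eq_zero {n : ℕ} {κ : Fin n →₀ ℕ}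
    {T : MvPolynomial (Fin n) ℂ →ₗ[ℂ] MvPolynomial (Fin n) ℂ}
    (hT : ∀ f : MvPolynomial (Fin n) ℂ, (∀ i, f.degreeOf i ≤ κ i) → IsStable (T f) ∨ T f = 0) :
    ∃ (a : MvPolynomial (Fin n) ℂ →ₗ[ℂ] ℂ) (P : MvPolynomial (Fin n) ℂ), IsStable P ∧
      ∀ f : MvPolynomial (Fin n) ℂ, (∀ i, f.degreeOf i ≤ κ i) → T f = a f • P := by
  by_cases hall : ∀ f : MvPolynomial (Fin n) ℂ, (∀ i, f.degreeOf i ≤ κ i) → T f = 0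
  · exact ⟨0, 1, fun z _ => by simp, fun f hf => by simp [hall f hf]⟩
  push Not at hall
  obtain ⟨g, hg, hg0⟩ := hall
  have hP := (hT g hg).resolve_right hg0
  set z : Fin n → ℂ := fun _ => Complex.I
  have hz : ∀ i, 0 < (z i).im := fun _ => by simp [z]
  refine ⟨(eval z (T g))⁻¹ • ((aeval z).toLinearMap ∘ₗ T), T g, hP, fun f hf => ?_⟩
  set c : ℂ := (eval z (T g))⁻¹ * eval z (T f) with hc
  have happ : ((eval z (T g))⁻¹ • ((aeval z).toLinearMap ∘ₗ T)) f = c := by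
    simp [hc, aeval_eq_eval]
  rw [happ, ← sub_eq_zero, ← map_smul, ← map_sub]
  refine (hT _ fun i => ?_).resolve_left fun hs => hs z hz ?_
  · refine (degreeOf_sub_le i _ _).trans (max_le (hf i) ?_)
    rw [smul_eq_C_mul]
    exact (degreeOf_C_mul_le _ _ _).trans (hg i)
  · rw [map_sub, map_smul, map_sub, smul_eval, hc]
    have := hP z hz
    field_simp
    ring

theorem sum_signed_eval_ne_zero_of_isStable_algSymbol {n : ℕ} {κ : Fin n →₀ ℕ}
    {T : MvPolynomial (Fin n) ℂ →ₗ[ℂ] MvPolynomial (Fin n) ℂ} (hG : IsStable (algSymbol κ T))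
    {z w : Fin n → ℂ} (hz : ∀ i, 0 < (z i).im) (hw : ∀ i, 0 < (w i).im) :
    ∑ α ∈ Finset.Iic κ, (∏ i, ((-1) ^ α i * ((κ i).choose (α i) : ℂ))) *
      eval z (T (monomial α 1)) * ∏ i, w i ^ α i ≠ 0 := by
  have hw0 : ∀ i, w i ≠ 0 := fun i h => by simpa [h] using hw i
  have h1 := hG (Sum.elim z fun i => -(w i)⁻¹) (by
    rintro (i | i)
    · exact hz i
    · simpa [Complex.inv_im, neg_div] using div_pos (hw i) (Complex.normSq_pos.mpr (hw0 i)))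
  rw [eval_algSymbol] at h1
  have h2 := mul_ne_zero (Finset.prod_ne_zero_iff.mpr fun i (_ : i ∈ Finset.univ) =>
    pow_ne_zero (κ i) (neg_ne_zero.mpr (hw0 i))) h1
  rw [Finset.mul_sum] at h2
  convert! h2 using 2 with α hα
  rw [← mul_assoc, mul_right_comm, ← Finset.prod_mul_distrib, ← Finset.prod_mul_distrib]
  congr 1
  refine Finset.prod_congr rfl fun i _ => ?_
  have hle : α i ≤ κ i := Finset.mem_Iic.mp hα i
  have h3 : (-w i) ^ κ i = (-1) ^ α i * w i ^ α i * (-w i) ^ (κ i - α i) := by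
    rw [← mul_pow, neg_one_mul, ← pow_add, Nat.add_sub_cancel' hle]
  have h4 : (-w i) ^ (κ i - α i) * (-(w i)⁻¹) ^ (κ i - α i) = 1 := by
    rw [← mul_pow, neg_mul_neg, mul_inv_cancel₀ (hw0 i), one_pow]
  rw [h3]
  linear_combination (-((-1) ^ α i * w i ^ α i * ((κ i).choose (α i) : ℂ))) * h4

theorem isStable_or_eq_zero_of_isStable_algSymbol {n : ℕ} {κ : Fin n →₀ ℕ}
    {T : MvPolynomial (Fin n) ℂ →ₗ[ℂ] MvPolynomial (Fin n) ℂ} (hG : IsStable (algSymbol κ T))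
    {f : MvPolynomial (Fin n) ℂ} (hf : ∀ i, f.degreeOf i ≤ κ i) (hs : IsStable f) :
    IsStable (T f) ∨ T f = 0 := by
  set W : ℂ → (Fin n →₀ ℕ) × (Fin n →₀ ℕ) → ℂ := fun e j =>
    f.coeff j.1 * (∏ i, ((-1) ^ j.2 i * ((κ i).choose (j.2 i) : ℂ))) *
      ∏ i, contractionWeight e (κ i) (j.1 i) (j.2 i) with hW
  set h : ℝ → MvPolynomial (Fin n) ℂ := fun ε =>
    ∑ j ∈ Finset.Iic κ ×ˢ Finset.Iic κ, W (ε * Complex.I) j • T (monomial j.2 1) with hh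
  have heval : ∀ ε z, eval z (h ε) = ∑ j ∈ Finset.Iic κ ×ˢ Finset.Iic κ,
      W (ε * Complex.I) j * eval z (T (monomial j.2 1)) := by
    intro ε z
    simp only [hh, map_sum, smul_eval]
  refine isStable_or_eq_zero_of_tendsto (l := nhdsWithin 0 (Set.Ioi 0)) (h := h)
    (D := (Finset.Iic κ ×ˢ Finset.Iic κ).sup fun j => (T (monomial j.2 1)).totalDegree) ?_ ?_ ?_
  · filter_upwards [self_mem_nhdsWithin] with ε hε z hz
    have hε' : 0 < (ε * Complex.I : ℂ).im := by simpa using hε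
    have key := contraction_prod_ne_zero hε' (J := Finset.Iic κ ×ˢ Finset.Iic κ) (κ := κ)
      (a := fun j => j.1) (b := fun j => j.2)
      (c := fun j => f.coeff j.1 * ((∏ i, ((-1) ^ j.2 i * ((κ i).choose (j.2 i) : ℂ))) *
        eval z (T (monomial j.2 1))))
      (fun j hj => Finset.mem_Iic.mp (Finset.mem_product.mp hj).1)
      (fun j hj => Finset.mem_Iic.mp (Finset.mem_product.mp hj).2) (fun v w hv hw => by
        have h1 := mul_ne_zero (hs v hv)
          (sum_signed_eval_ne_zero_of_isStable_algSymbol hG hz hw)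
        rw [eval_eq_sum_Iic hf, Finset.sum_mul_sum, ← Finset.sum_product'] at h1
        convert! h1 using 2 with j hj
        simp only [Finset.prod_mul_distrib]
        ring)
    rw [heval]
    convert! key using 2 with j hj
    simp only [hW]
    ring
  · refine Filter.Eventually.of_forall fun ε => ?_
    refine (totalDegree_finsetSum _ _).trans (Finset.sup_mono_fun fun j _ => ?_)
    exact totalDegree_smul_le _ _
  · intro z
    have hcont : Continuous fun ε : ℝ => eval z (h ε) := by
      simp only [heval, hW]
      have hc : ∀ k a b, Continuous fun ε : ℝ => contractionWeight (ε * Complex.I) k a b :=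
        fun k a b => (continuous_contractionWeight k a b).comp
          (Complex.continuous_ofReal.mul continuous_const)
      fun_prop
    have hval : eval z (h 0) = eval z (T f) := by
      rw [heval, Finset.sum_product, linearMap_apply_eq_sum_Iic hf, map_sum]
      refine Finset.sum_congr rfl fun α hα => ?_
      rw [smul_eval, Finset.sum_eq_single α]
      · have hle := Finset.mem_Iic.mp hα
        have : (∏ i, ((-1) ^ α i * ((κ i).choose (α i) : ℂ))) *
            ∏ i, contractionWeight 0 (κ i) (α i) (α i) = 1 := by
          rw [← Finset.prod_mul_distrib]
          refine Finset.prod_eq_one fun i _ => ?_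
          have hne : ((κ i).choose (α i) : ℂ) ≠ 0 := by
            exact_mod_cast (Nat.choose_pos (hle i)).ne'
          rw [contractionWeight_zero (hle i) (hle i), if_pos rfl]
          field_simp
          rw [← pow_mul, mul_comm, pow_mul]
          simp
        simp only [hW, Complex.ofReal_zero, zero_mul]
        rw [mul_assoc (f.coeff α), this, mul_one]
      · intro β hβ hne
        obtain ⟨i, hi⟩ : ∃ i, α i ≠ β i := by
          by_contra! hcon
          exact hne (Finsupp.ext hcon).symm
        have : ∏ i, contractionWeight 0 (κ i) (α i) (β i) = 0 :=
          Finset.prod_eq_zero (Finset.mem_univ i) (by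
            rw [contractionWeight_zero (Finset.mem_Iic.mp hα i) (Finset.mem_Iic.mp hβ i),
              if_neg hi])
        simp only [hW, Complex.ofReal_zero, zero_mul]
        rw [this, mul_zero, zero_mul]
      · exact fun h' => (h' hα).elim
    rw [← hval]
    exact hcont.continuousAt.tendsto.mono_left nhdsWithin_le_nhds

/-- Theorem 1 (Borcea–Brändén): a linear operator
`T : ℂ_κ[z₁,…,zₙ] → ℂ[z₁,…,zₙ]` preserves stability if and only if either
(a) `T` has range of dimension at most one, being of the form `T(f) = α(f)·P`
with `P` stable, or (b) its algebraic symbol `G_T(z,w) = T[(z+w)^κ]` is a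
stable polynomial in `2n` variables. -/
theorem stability_preserver_finite_complex (n : ℕ) (hn : 1 ≤ n) (κ : Fin n →₀ ℕ)
    (T : MvPolynomial (Fin n) ℂ →ₗ[ℂ] MvPolynomial (Fin n) ℂ) :
    (∀ f : MvPolynomial (Fin n) ℂ, (∀ i, f.degreeOf i ≤ κ i) → IsStable f →
        IsStable (T f) ∨ T f = 0) ↔
      ((∃ (a : MvPolynomial (Fin n) ℂ →ₗ[ℂ] ℂ) (P : MvPolynomial (Fin n) ℂ),
          IsStable P ∧
            ∀ f : MvPolynomial (Fin n) ℂ, (∀ i, f.degreeOf i ≤ κ i) → T f = a f • P) ∨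
        IsStable (algSymbol κ T)) := by
  constructor
  · intro hT
    by_cases hw : ∃ w : Fin n → ℂ, (∀ i, 0 < (w i).im) ∧ T (shiftedPower κ w) = 0
    · obtain ⟨w, hw, h0⟩ := hw
      exact Or.inl (exists_functional_of_forall_isStable_or_eq_zero fun f hf =>
        isStable_or_eq_zero_of_map_shiftedPower_eq_zero hT hw h0 hf)
    · push Not at hw
      refine Or.inr fun x hx => ?_
      have hx' : ∀ i, 0 < ((x ∘ Sum.inr) i).im := fun i => hx (Sum.inr i)
      have hs := (hT _ (degreeOf_shiftedPower_le κ (x ∘ Sum.inr))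
        (isStable_shiftedPower κ hx')).resolve_right (hw _ hx')
      have := hs (x ∘ Sum.inl) fun i => hx (Sum.inl i)
      rwa [eval_map_shiftedPower, Sum.elim_comp_inl_inr] at this
  · rintro (⟨a, P, hP, hT⟩ | hG) f hf hs
    · rw [hT f hf]
      by_cases ha : a f = 0
      · exact Or.inr (by rw [ha, zero_smul])
      · refine Or.inl fun z hz => ?_
        rw [smul_eval]
        exact mul_ne_zero ha (hP z hz)
    · exact isStable_or_eq_zero_of_isStable_algSymbol hG hf hs
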